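/- For integers 2 ≤ r ≤ s, the Turán graph T(s,r) is inducibility diverse if and only if s = r, i.e., if and only if T(s,r) is a complete graph. -/

import Mathlib

open Filter Topology

/-- The number of `|V(F)|`-element subsets of the vertex set of `G` that induce a
subgraph isomorphic to `F`. -/
noncomputable def inducedCount {α β : Type*} [Fintype α] [Fintype β]
    (F : SimpleGraph α) (G : SimpleGraph β) : ℕ :=
  Set.ncard {s : Finset β | s.card = Fintype.card α ∧
    Nonempty (F ≃g SimpleGraph.induce (↑s : Set β) G)}

/-- The induced density `p(F,G) = P(F,G)/C(n,r)`. -/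
noncomputable def inducedDensity {α β : Type*} [Fintype α] [Fintype β]
    (F : SimpleGraph α) (G : SimpleGraph β) : ℝ :=
  (inducedCount F G : ℝ) / ((Fintype.card β).choose (Fintype.card α))

/-- `i_k(F,n)`: the maximum induced density of `F` over `K_k`-free graphs on `n` vertices. -/
noncomputable def ikn {α : Type*} [Fintype α] (F : SimpleGraph α) (k n : ℕ) : ℝ :=
  sSup {x : ℝ | ∃ G : SimpleGraph (Fin n), G.CliqueFree k ∧ x = inducedDensity F G}

/-- `i_k(F) = lim_{n → ∞} i_k(F,n)`. -/
noncomputable def ik {α : Type*} [Fintype α] (F : SimpleGraph α) (k : ℕ) : ℝ :=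
  limUnder atTop (fun n => ikn F k n)

/-- A graph `F` is inducibility diverse if for every `k` there is `m > k`
with `i_k(F) < i_m(F)`. -/
def InducibilityDiverse {α : Type*} [Fintype α] (F : SimpleGraph α) : Prop :=
  ∀ k : ℕ, ∃ m : ℕ, k < m ∧ ik F k < ik F m

section

open Finset

open Classical in
/-- The weighted density of `F` in the independent-set blow-up of `G` with part sizes `x`: the
probability that a random map with independent `x`-distributed values induces exactly `F`. -/
noncomputable def blowupDensity {α V : Type*} [Fintype α] [Fintype V]
    (F : SimpleGraph α) (G : SimpleGraph V) (x : V → ℝ) : ℝ :=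
  ∑ f : α → V, (∏ i, x (f i)) * if G.comap f = F then 1 else 0

section Sums

variable {α β V W : Type*} [Fintype α] [Fintype β] [Fintype V] [Fintype W]

theorem sum_prod_mul_comp_embedding [DecidableEq α] [DecidableEq β] {x : V → ℝ} (hx : ∑ v, x v = 1) (e : α ↪ β)
    (h : (α → V) → ℝ) :
    ∑ g : β → V, (∏ b, x (g b)) * h (g ∘ e) = ∑ f : α → V, (∏ a, x (f a)) * h f := by
  classical
  rw [← Finset.sum_fiberwise univ (fun g : β → V => g ∘ e)]
  refine Finset.sum_congr rfl fun f _ => ?_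
  have key : ({g : β → V | g ∘ e = f} : Finset (β → V)) =
      Fintype.piFinset (fun b => ({v : V | ∀ a, e a = b → v = f a} : Finset V)) := by
    ext g
    simp only [mem_filter, mem_univ, true_and, Fintype.mem_piFinset, funext_iff,
      Function.comp_apply]
    exact ⟨fun H b a hab => hab ▸ H a, fun H a => H _ a rfl⟩
  have : ∀ g ∈ ({g : β → V | g ∘ e = f} : Finset (β → V)),
      (∏ b, x (g b)) * h (g ∘ e) = (∏ b, x (g b)) * h f := by
    intro g hg
    rw [(mem_filter.1 hg).2]
  rw [Finset.sum_congr rfl this, ← Finset.sum_mul, key, ← Finset.prod_univ_sum]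
  congr 1
  rw [← Finset.prod_subset (Finset.subset_univ (univ.map e)), Finset.prod_map]
  · refine Finset.prod_congr rfl fun a _ => ?_
    have : ({v : V | ∀ a', e a' = e a → v = f a'} : Finset V) = {f a} := by
      ext v
      simp
    rw [this, Finset.sum_singleton]
  · intro b _ hb
    have : ({v : V | ∀ a, e a = b → v = f a} : Finset V) = univ := by
      ext v
      simp only [mem_filter, mem_univ, true_and, iff_true]
      intro a ha
      exact absurd (Finset.mem_map.2 ⟨a, mem_univ _, ha⟩) hb
    rw [this, hx]

theorem sum_prod_eq_one [DecidableEq α] {x : V → ℝ} (hx : ∑ v, x v = 1) :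
    ∑ f : α → V, ∏ a, x (f a) = 1   := by
  have := (Finset.prod_univ_sum (fun _ : α => (univ : Finset V)) fun _ v => x v)
  simpa [hx] using this.symm

theorem sum_prod_mul_pair [DecidableEq α] {x : V → ℝ} (hx : ∑ v, x v = 1) {i j : α} (hij : i ≠ j)
    (h : V → V → ℝ) :
    ∑ f : α → V, (∏ a, x (f a)) * h (f i) (f j) = ∑ v, ∑ w, x v * x w * h v w := by
  have hinj : Function.Injective ![i, j] := by
    intro a b
    fin_cases a <;> fin_cases b <;> simp [hij, hij.symm]
  have := sum_prod_mul_comp_embedding hx ⟨![i, j], hinj⟩ (fun f => h (f 0) (f 1))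
  simp only [Function.comp_apply, Function.Embedding.coeFn_mk, Matrix.cons_val_zero,
    Matrix.cons_val_one] at this
  rw [this, ← (finTwoArrowEquiv V).symm.sum_comp, Fintype.sum_prod_type]
  simp [Fin.prod_univ_two, finTwoArrowEquiv]

theorem sum_prod_map_mul [DecidableEq α] [DecidableEq W] (x : V → ℝ) (p : V → W) (h : (α → W) → ℝ) :
    ∑ f : α → W, (∏ a, ∑ v with p v = f a, x v) * h f =
      ∑ g : α → V, (∏ a, x (g a)) * h (p ∘ g) := by
  rw [← Finset.sum_fiberwise univ (fun g : α → V => p ∘ g)]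
  refine Finset.sum_congr rfl fun f _ => ?_
  have key : ({g : α → V | p ∘ g = f} : Finset (α → V)) =
      Fintype.piFinset (fun a => ({v : V | p v = f a} : Finset V)) := by
    ext g
    simp [funext_iff]
  have : ∀ g ∈ ({g : α → V | p ∘ g = f} : Finset (α → V)),
      (∏ a, x (g a)) * h (p ∘ g) = (∏ a, x (g a)) * h f := by
    intro g hg
    rw [(mem_filter.1 hg).2]
  rw [Finset.sum_congr rfl this, ← Finset.sum_mul, key, ← Finset.prod_univ_sum]

end Sums

section BlowupDensity

variable {α V W : Type*} [Fintype α] [Fintype V] [Fintype W]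
  {F : SimpleGraph α} {G : SimpleGraph V} {x : V → ℝ}

omit [Fintype α] [Fintype V] in
theorem comap_eq_iff {f : α → V} :
    G.comap f = F ↔ ∀ i j, G.Adj (f i) (f j) ↔ F.Adj i j := by
  simp [SimpleGraph.ext_iff, funext_iff]

theorem blowupDensity_nonneg (hx : ∀ v, 0 ≤ x v) : 0 ≤ blowupDensity F G x :=
  Finset.sum_nonneg fun f _ =>
    mul_nonneg (Finset.prod_nonneg fun i _ => hx _) (by split_ifs <;> simp)

theorem blowupDensity_le_one (hx : x ∈ stdSimplex ℝ V) : blowupDensity F G x ≤ 1 := by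
  classical
  rw [← sum_prod_eq_one (α := α) hx.2]
  refine Finset.sum_le_sum fun f _ => ?_
  refine mul_le_of_le_one_right (Finset.prod_nonneg fun i _ => hx.1 _) ?_
  split_ifs <;> simp

theorem continuous_blowupDensity : Continuous fun x : V → ℝ => blowupDensity F G x := by
  unfold blowupDensity
  fun_prop

theorem blowupDensity_smul (c : ℝ) :
    blowupDensity F G (c • x) = c ^ Fintype.card α * blowupDensity F G x := by
  simp [blowupDensity, Finset.prod_mul_distrib, Finset.mul_sum, mul_assoc, -mul_ite]

open Classical in
theorem blowupDensity_map (G : SimpleGraph W) (x : V → ℝ) (p : V → W) :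
    blowupDensity F G (fun w => ∑ v with p v = w, x v) = blowupDensity F (G.comap p) x := by
  unfold blowupDensity
  exact sum_prod_map_mul x p (fun f => if G.comap f = F then 1 else 0)

theorem blowupDensity_congr_of_clique {G' : SimpleGraph V}
    (h : ∀ u v, x u ≠ 0 → x v ≠ 0 → (G.Adj u v ↔ G'.Adj u v)) :
    blowupDensity F G x = blowupDensity F G' x := by
  classical
  unfold blowupDensity
  refine Finset.sum_congr rfl fun f _ => ?_
  by_cases h0 : ∏ i, x (f i) = 0
  · simp [h0]
  · rw [Finset.prod_eq_zero_iff] at h0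
    simp only [mem_univ, true_and, not_exists] at h0
    have : G.comap f = F ↔ G'.comap f = F := by
      rw [comap_eq_iff, comap_eq_iff]
      exact forall₂_congr fun i j => by
        rw [h _ _ (h0 i) (h0 j)]
    rw [if_congr this rfl rfl]

theorem exists_max_blowupDensity [Nonempty V] (F : SimpleGraph α) (G : SimpleGraph V) :
    ∃ x ∈ stdSimplex ℝ V, (∀ y ∈ stdSimplex ℝ V, blowupDensity F G y ≤ blowupDensity F G x) ∧
      ∀ y ∈ stdSimplex ℝ V, blowupDensity F G x ≤ blowupDensity F G y →
        #{v | x v ≠ 0} ≤ #{v | y v ≠ 0} := by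
  classical
  obtain ⟨x₀, hx₀, hmax⟩ := (isCompact_stdSimplex ℝ V).exists_isMaxOn
    ⟨_, single_mem_stdSimplex ℝ (Classical.arbitrary V)⟩
    (continuous_blowupDensity (F := F) (G := G)).continuousOn
  obtain ⟨x, ⟨hx, hxx₀⟩, hmin⟩ := exists_minimalFor_of_wellFoundedLT
    (fun y => y ∈ stdSimplex ℝ V ∧ blowupDensity F G x₀ ≤ blowupDensity F G y)
    (fun y => #{v | y v ≠ 0}) ⟨x₀, hx₀, le_rfl⟩
  refine ⟨x, hx, fun y hy => (hmax hy).trans hxx₀, fun y hy hxy => ?_⟩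
  by_contra! hlt
  exact absurd (hmin ⟨hy, hxx₀.trans hxy⟩ hlt.le) (not_le.2 hlt)

omit [Fintype α] [Fintype V] in
/-- Nonadjacent vertices `i`, `i'` of `F` have the same neighbours, so an induced copy of `F`
containing `u` stays one when every occurrence of the nonadjacent vertex `v` becomes `u`. -/
theorem comap_update_eq [DecidableEq V] (hF : ∀ i j k, ¬F.Adj i j → ¬F.Adj j k → ¬F.Adj i k)
    {u v : V} (huv : ¬G.Adj u v) {f : α → V} (hf : G.comap f = F) {i₀ : α} (hi₀ : f i₀ = u) :
    G.comap (Function.update id v u ∘ f) = F := by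
  rw [comap_eq_iff] at hf ⊢
  have twin : ∀ i j, f i = v → (G.Adj u (f j) ↔ F.Adj i j) := by
    intro i j hi
    have h1 : ¬F.Adj i₀ i := by rwa [← hf, hi₀, hi]
    have h2 : ¬F.Adj i i₀ := fun h => h1 h.symm
    rw [← hi₀, hf]
    have := hF i₀ i j h1
    have := hF i i₀ j h2
    tauto
  intro i j
  by_cases hi : f i = v <;> by_cases hj : f j = v
  · have : ¬F.Adj i j := by rw [← hf, hi, hj]; exact G.loopless.irrefl v
    simpa [hi, hj] using this
  · simpa [hi, hj] using twin i j hi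
  · rw [G.adj_comm, F.adj_comm]
    simpa [hi, hj] using twin j i hj
  · simpa [hi, hj] using hf i j

/-- The weights obtained from `x` by moving the weight of `v` to `u`. -/
theorem map_update_id [DecidableEq V] {u v : V} (huv : u ≠ v) (x : V → ℝ) :
    (fun w => ∑ a with Function.update id v u a = w, x a) =
      Function.update (Function.update x u (x u + x v)) v 0 := by
  funext w
  by_cases hwv : w = v
  · subst hwv
    rw [Function.update_self, Finset.sum_eq_zero]
    intro a ha
    by_cases h : a = w <;> simp [h, huv] at ha
  · rw [Function.update_of_ne hwv]
    by_cases hwu : w = u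
    · subst hwu
      have : ({a | Function.update id v w a = w} : Finset V) = {w, v} := by
        ext a
        by_cases h : a = v <;> simp [h]
      rw [this, Finset.sum_pair huv, Function.update_self]
    · have : ({a | Function.update id v u a = w} : Finset V) = {w} := by
        ext a
        by_cases h : a = v
        · simp [h, Ne.symm hwu, Ne.symm hwv]
        · simp [h]
      rw [this, Finset.sum_singleton, Function.update_of_ne hwu]

theorem update_update_mem_stdSimplex [DecidableEq V] (hx : x ∈ stdSimplex ℝ V) {u v : V}
    (huv : u ≠ v) {a b : ℝ} (ha : 0 ≤ a) (hb : 0 ≤ b) (hab : a + b = x u + x v) :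
    Function.update (Function.update x u a) v b ∈ stdSimplex ℝ V := by
  refine ⟨fun w => ?_, ?_⟩
  · have := hx.1 w
    by_cases h : w = v
    · simpa [h] using hb
    · by_cases h' : w = u
      · simpa [h', huv] using ha
      · simpa [h, h'] using this
  · have h1 := hx.2
    have huv' : u ∈ univ \ {v} := by simp [huv]
    rw [← Finset.add_sum_erase _ _ (mem_univ v),
      ← Finset.add_sum_erase _ _ (show u ∈ univ.erase v by simp [huv])] at h1 ⊢
    rw [Function.update_self, Function.update_of_ne huv, Function.update_self,
      Finset.sum_congr rfl (g := x)]
    · linarith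
    · intro w hw
      simp only [mem_erase] at hw
      rw [Function.update_of_ne hw.2.1, Function.update_of_ne hw.1]

theorem card_support_update_lt [DecidableEq V] {u v : V} (a : ℝ) (hu : x u ≠ 0) (hv : x v ≠ 0) :
    #{w | Function.update (Function.update x u a) v 0 w ≠ 0} < #{w | x w ≠ 0} := by
  refine Finset.card_lt_card (Finset.ssubset_iff_of_subset ?_ |>.2 ⟨v, by simpa using hv, by simp⟩)
  intro w
  by_cases h : w = v
  · simp [h]
  · by_cases h' : w = u
    · simp [h', hu]
    · simp [h, h']

end BlowupDensity

section Symmetrization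

variable {α V : Type*} [Fintype α] [Fintype V] {F : SimpleGraph α} {G : SimpleGraph V} {x : V → ℝ}

/-- Zykov symmetrization: the density is at most the corresponding convex combination of the
densities after moving all the weight of two nonadjacent vertices `u`, `v` to one of them. -/
theorem add_mul_blowupDensity_le [DecidableEq V]
    (hF : ∀ i j k, ¬F.Adj i j → ¬F.Adj j k → ¬F.Adj i k) (hx : ∀ w, 0 ≤ x w)
    {u v : V} (huv : u ≠ v) (hG : ¬G.Adj u v) :
    (x u + x v) * blowupDensity F G x ≤
      x u * blowupDensity F G (Function.update (Function.update x u (x u + x v)) v 0) +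
      x v * blowupDensity F G (Function.update (Function.update x v (x v + x u)) u 0) := by
  classical
  obtain ⟨sel, hsel⟩ : ∃ sel : Finset α → Option α, ∀ J, (J = ∅ ∧ sel J = none) ∨
      ∃ i ∈ J, sel J = some i := by
    refine ⟨fun J => if h : J.Nonempty then some h.choose else none, fun J => ?_⟩
    by_cases h : J.Nonempty
    · exact .inr ⟨h.choose, h.choose_spec, by simp [h]⟩
    · exact .inl ⟨Finset.not_nonempty_iff_eq_empty.1 h, by simp [h]⟩
  let J : (α → V) → Finset α := fun f => {i | f i = u ∨ f i = v}
  let toggle : (α → V) → (α → V) := fun f i =>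
    if sel (J f) = some i then Equiv.swap u v (f i) else f i
  have hswap : ∀ w, (Equiv.swap u v w = u ∨ Equiv.swap u v w = v) ↔ (w = u ∨ w = v) := by
    intro w
    by_cases h1 : w = u
    · simp [h1]
    · by_cases h2 : w = v
      · simp [h2]
      · simp [Equiv.swap_apply_of_ne_of_ne h1 h2]
  have hJ : ∀ f, J (toggle f) = J f := by
    intro f
    ext i
    simp only [J, mem_filter, mem_univ, true_and, toggle]
    split_ifs
    · exact hswap _
    · rfl
  have hinv : Function.Involutive toggle := by
    intro f
    funext i
    change (if sel (J (toggle f)) = some i then Equiv.swap u v (toggle f i) else toggle f i) = f i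
    rw [hJ]
    by_cases h : sel (J f) = some i <;> simp [toggle, h]
  let pu : V → V := Function.update id v u
  let pv : V → V := Function.update id u v
  have hpu : ∀ w, pu (Equiv.swap u v w) = pu w := by
    intro w
    by_cases h1 : w = u
    · simp [h1, pu, huv]
    · by_cases h2 : w = v
      · simp [h2, pu, huv]
      · simp [Equiv.swap_apply_of_ne_of_ne h1 h2]
  have hpv : ∀ w, pv (Equiv.swap u v w) = pv w := by
    intro w
    by_cases h1 : w = u
    · simp [h1, pv, huv.symm]
    · by_cases h2 : w = v
      · simp [h2, pv, huv.symm]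
      · simp [Equiv.swap_apply_of_ne_of_ne h1 h2]
  have hpu' : ∀ f, pu ∘ toggle f = pu ∘ f := by
    intro f
    funext i
    simp only [Function.comp_apply, toggle]
    split_ifs
    · exact hpu _
    · rfl
  have hpv' : ∀ f, pv ∘ toggle f = pv ∘ f := by
    intro f
    funext i
    simp only [Function.comp_apply, toggle]
    split_ifs
    · exact hpv _
    · rfl
  let ind : (α → V) → ℝ := fun f => if G.comap f = F then 1 else 0
  have ind_nonneg : ∀ f, 0 ≤ ind f := fun f => by dsimp only [ind]; split_ifs <;> simp
  let κ : (α → V) → ℝ := fun f =>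
    (sel (J f)).elim 0 fun i => if f i = u then x v else - x u
  have hκ : ∀ f, κ f * ∏ i, x (f i) + κ (toggle f) * ∏ i, x (toggle f i) = 0 := by
    intro f
    rcases hsel (J f) with ⟨-, h⟩ | ⟨i, hi, h⟩
    · simp [κ, hJ, h]
    · have e1 : ∏ j, x (toggle f j) = x (Equiv.swap u v (f i)) * ∏ j ∈ univ.erase i, x (f j) := by
        rw [← Finset.mul_prod_erase _ _ (mem_univ i)]
        congr 1
        · simp [toggle, h]
        · refine Finset.prod_congr rfl fun j hj => ?_
          have : i ≠ j := (Finset.ne_of_mem_erase hj).symm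
          simp [toggle, h, this]
      have e2 : toggle f i = Equiv.swap u v (f i) := by simp [toggle, h]
      simp only [κ, hJ, h, Option.elim_some, e1, e2]
      rw [← Finset.mul_prod_erase _ _ (mem_univ i)]
      simp only [J, mem_filter, mem_univ, true_and] at hi
      rcases hi with hi | hi
      · simp only [hi, Equiv.swap_apply_left, if_true, huv.symm, if_false]
        ring
      · simp only [hi, Equiv.swap_apply_right, if_true, huv.symm, if_false]
        ring
  have hzero : ∑ f, κ f * (∏ i, x (f i)) * (ind (pu ∘ f) - ind (pv ∘ f)) = 0 := by
    have h2 := (Equiv.sum_comp hinv.toPerm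
      fun f => κ f * (∏ i, x (f i)) * (ind (pu ∘ f) - ind (pv ∘ f)))
    simp only [Function.Involutive.coe_toPerm, hpu', hpv'] at h2
    have h3 := Finset.sum_add_distrib (s := univ)
      (f := fun f => κ f * (∏ i, x (f i)) * (ind (pu ∘ f) - ind (pv ∘ f)))
      (g := fun f => κ (toggle f) * (∏ i, x (toggle f i)) * (ind (pu ∘ f) - ind (pv ∘ f)))
    rw [h2, Finset.sum_eq_zero] at h3
    · linarith
    · intro f _
      rw [← add_mul, hκ, zero_mul]
  have hpt : ∀ f, (x u + x v) * ind f ≤ x u * ind (pu ∘ f) + x v * ind (pv ∘ f) +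
      κ f * (ind (pu ∘ f) - ind (pv ∘ f)) := by
    intro f
    have hxu := hx u
    have hxv := hx v
    rcases hsel (J f) with ⟨h0, h⟩ | ⟨i, hi, h⟩
    · have hne : ∀ i, f i ≠ u ∧ f i ≠ v := by
        intro i
        have := Finset.eq_empty_iff_forall_notMem.1 h0 i
        simpa [J] using this
      have h1 : pu ∘ f = f := by funext i; simp [pu, hne i]
      have h2 : pv ∘ f = f := by funext i; simp [pv, hne i]
      rw [h1, h2]
      simp [κ, h, add_mul]
    · simp only [J, mem_filter, mem_univ, true_and] at hi
      by_cases hf : G.comap f = F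
      · have hf1 : ind f = 1 := by simp [ind, hf]
        by_cases hiu : f i = u
        · have h1 : ind (pu ∘ f) = 1 := if_pos (comap_update_eq hF hG hf hiu)
          simp only [κ, h, Option.elim_some, hiu, if_true, hf1, h1]
          linarith
        · have hiv : f i = v := hi.resolve_left hiu
          have h1 : ind (pv ∘ f) = 1 := if_pos
            (comap_update_eq hF (fun h => hG h.symm) hf hiv)
          simp only [κ, h, Option.elim_some, hiv, huv.symm, if_false, hf1, h1]
          linarith
      · have hf0 : ind f = 0 := by simp [ind, hf]
        have := ind_nonneg (pu ∘ f)
        have := ind_nonneg (pv ∘ f)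
        by_cases hiu : f i = u
        · simp only [κ, h, Option.elim_some, hiu, if_true, hf0]
          nlinarith
        · simp only [κ, h, Option.elim_some, hiu, if_false, hf0]
          nlinarith
  have hy := map_update_id huv x
  have hz := map_update_id huv.symm x
  have hy' := blowupDensity_map (F := F) G x pu
  have hz' := blowupDensity_map (F := F) G x pv
  have hy'' : blowupDensity F (G.comap pu) x = ∑ f : α → V, (∏ i, x (f i)) * ind (pu ∘ f) := rfl
  have hz'' : blowupDensity F (G.comap pv) x = ∑ f : α → V, (∏ i, x (f i)) * ind (pv ∘ f) := rfl
  have hx'' : blowupDensity F G x = ∑ f : α → V, (∏ i, x (f i)) * ind f := rfl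
  have hyy : blowupDensity F G (Function.update (Function.update x u (x u + x v)) v 0) =
      ∑ f : α → V, (∏ i, x (f i)) * ind (pu ∘ f) := by
    rw [← hy, ← hy'', ← hy']
    congr!
  have hzz : blowupDensity F G (Function.update (Function.update x v (x v + x u)) u 0) =
      ∑ f : α → V, (∏ i, x (f i)) * ind (pv ∘ f) := by
    rw [← hz, ← hz'', ← hz']
    congr!
  rw [hyy, hzz, hx'']
  refine le_of_le_of_eq ?_ ((congrArg (_ + ·) hzero).trans (add_zero _))
  rw [Finset.mul_sum, Finset.mul_sum, Finset.mul_sum, ← Finset.sum_add_distrib,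
    ← Finset.sum_add_distrib]
  refine Finset.sum_le_sum fun f _ => ?_
  have := mul_le_mul_of_nonneg_left (hpt f) (Finset.prod_nonneg fun i (_ : i ∈ univ) => hx (f i))
  linarith

theorem isClique_support_of_max (hF : ∀ i j k, ¬F.Adj i j → ¬F.Adj j k → ¬F.Adj i k)
    (hx : x ∈ stdSimplex ℝ V)
    (hmax : ∀ y ∈ stdSimplex ℝ V, blowupDensity F G y ≤ blowupDensity F G x)
    (hmin : ∀ y ∈ stdSimplex ℝ V, blowupDensity F G x ≤ blowupDensity F G y →
      #{v | x v ≠ 0} ≤ #{v | y v ≠ 0}) :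
    G.IsClique {v | x v ≠ 0} := by
  classical
  intro u hu v hv huv
  by_contra hG
  have hu' : 0 < x u := lt_of_le_of_ne (hx.1 u) (Ne.symm hu)
  have hv' : 0 < x v := lt_of_le_of_ne (hx.1 v) (Ne.symm hv)
  have key := add_mul_blowupDensity_le hF hx.1 huv hG
  have hy := update_update_mem_stdSimplex hx huv (a := x u + x v) (b := 0) (by positivity) le_rfl
    (by simp)
  have hz := update_update_mem_stdSimplex hx huv.symm (a := x v + x u) (b := 0) (by positivity)
    le_rfl (by simp)
  have h1 := hmax _ hy
  have h2 := hmax _ hz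
  have h3 : blowupDensity F G x ≤
      blowupDensity F G (Function.update (Function.update x u (x u + x v)) v 0) := by
    nlinarith
  exact absurd (hmin _ hy h3) (not_le.2 (by convert card_support_update_lt _ hu hv))

theorem exists_isClique_support [Nonempty V]
    (hF : ∀ i j k, ¬F.Adj i j → ¬F.Adj j k → ¬F.Adj i k) (G : SimpleGraph V)
    (hx : x ∈ stdSimplex ℝ V) :
    ∃ y ∈ stdSimplex ℝ V, G.IsClique {v | y v ≠ 0} ∧
      blowupDensity F G x ≤ blowupDensity F G y := by
  obtain ⟨y, hy, hmax, hmin⟩ := exists_max_blowupDensity F G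
  exact ⟨y, hy, isClique_support_of_max hF hy hmax hmin, hmax x hx⟩

end Symmetrization

section CompletePartite

variable {α V : Type*} [Fintype α] [Fintype V] {F : SimpleGraph α} {x : V → ℝ}

omit [Fintype α] [Fintype V] in
theorem comap_top_eq_iff {f : α → V} :
    (⊤ : SimpleGraph V).comap f = F ↔ ∀ i j, f i = f j ↔ ¬F.Adj i j := by
  rw [comap_eq_iff]
  refine forall₂_congr fun i j => ?_
  rw [SimpleGraph.top_adj]
  tauto

theorem blowupDensity_le_pow_mul {G : SimpleGraph V} {M : ℝ}
    (hM : ∀ y ∈ stdSimplex ℝ V, blowupDensity F G y ≤ M) {z : V → ℝ} (hz : ∀ v, 0 ≤ z v)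
    (hpos : 0 < ∑ v, z v) : blowupDensity F G z ≤ (∑ v, z v) ^ Fintype.card α * M := by
  set c := ∑ v, z v with hc
  have h1 : z = c • (c⁻¹ • z) := by rw [smul_smul, mul_inv_cancel₀ hpos.ne', one_smul]
  rw [h1, blowupDensity_smul]
  refine mul_le_mul_of_nonneg_left (hM _ ⟨fun v => ?_, ?_⟩) (by positivity)
  · have := hz v
    simp only [Pi.smul_apply, smul_eq_mul]
    positivity
  · simp only [Pi.smul_apply, smul_eq_mul, ← Finset.mul_sum, ← hc]
    exact inv_mul_cancel₀ hpos.ne'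

theorem blowupDensity_top_le_card_mul [Nonempty α] (hF : ∀ i, ∃ j, j ≠ i ∧ ¬F.Adj i j)
    (hx : x ∈ stdSimplex ℝ V)
    (hmax : ∀ y ∈ stdSimplex ℝ V, blowupDensity F ⊤ y ≤ blowupDensity F ⊤ x)
    {u : V} (hu : x u ≠ 0) : blowupDensity F ⊤ x ≤ Fintype.card α * x u := by
  classical
  choose σ hσ hFσ using hF
  have hupos : 0 < x u := lt_of_le_of_ne (hx.1 u) (Ne.symm hu)
  have hcard : (1 : ℝ) ≤ Fintype.card α := by exact_mod_cast Fintype.card_pos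
  have hM := blowupDensity_le_one (F := F) (G := ⊤) hx
  have hM0 := blowupDensity_nonneg (F := F) (G := ⊤) hx.1
  set M := blowupDensity F ⊤ x with hMdef
  have hsplit := Finset.add_sum_erase univ x (mem_univ u)
  rw [hx.2] at hsplit
  have hsum : ∑ v, Function.update x u 0 v = 1 - x u := by
    rw [Finset.sum_update_of_mem (mem_univ u), Finset.sdiff_singleton_eq_erase]
    linarith
  have hrest : 0 ≤ ∑ v ∈ univ.erase u, x v := Finset.sum_nonneg fun v _ => hx.1 v
  rcases eq_or_lt_of_le (show x u ≤ 1 by linarith) with h1 | h1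
  · rw [h1, mul_one]
    exact hM.trans hcard
  have hz : ∀ v, 0 ≤ Function.update x u 0 v := by
    intro v
    by_cases h : v = u
    · simp [h]
    · simpa [h] using hx.1 v
  have hle : M ≤ blowupDensity F ⊤ (Function.update x u 0) + Fintype.card α * x u ^ 2 := by
    have hpair : ∀ i, ∑ f : α → V, (∏ a, x (f a)) * (if f i = u ∧ f (σ i) = u then 1 else 0) =
        x u ^ 2 := by
      intro i
      rw [sum_prod_mul_pair hx.2 (hσ i).symm (fun a b => if a = u ∧ b = u then 1 else 0)]
      simp [ite_and, sq]
    have : Fintype.card α * x u ^ 2 = ∑ f : α → V, ∑ i : α,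
        (∏ a, x (f a)) * (if f i = u ∧ f (σ i) = u then 1 else 0) := by
      rw [Finset.sum_comm]
      simp only [hpair]
      simp
    rw [this, hMdef]
    unfold blowupDensity
    rw [← Finset.sum_add_distrib]
    refine Finset.sum_le_sum fun f _ => ?_
    have hprod : 0 ≤ ∏ a, x (f a) := Finset.prod_nonneg fun a _ => hx.1 _
    have hnn : ∀ i ∈ univ, 0 ≤ (∏ a, x (f a)) * (if f i = u ∧ f (σ i) = u then (1 : ℝ) else 0) :=
      fun i _ => mul_nonneg hprod (by split_ifs <;> simp)
    by_cases hf : (⊤ : SimpleGraph V).comap f = F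
    · rw [if_pos hf, mul_one, mul_one]
      by_cases hfu : ∃ i, f i = u
      · obtain ⟨i, hi⟩ := hfu
        have hi' : f (σ i) = u := by
          rw [← hi]
          exact ((comap_top_eq_iff.1 hf _ _).2 (hFσ i)).symm
        have h2 := Finset.single_le_sum hnn (mem_univ i)
        simp only [hi, hi', and_self, if_true, mul_one] at h2
        have h3 : 0 ≤ ∏ a, Function.update x u 0 (f a) := Finset.prod_nonneg fun a _ => hz _
        linarith
      · push Not at hfu
        have : ∏ a, Function.update x u 0 (f a) = ∏ a, x (f a) :=
          Finset.prod_congr rfl fun a _ => by rw [Function.update_of_ne (hfu a)]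
        rw [this]
        linarith [Finset.sum_nonneg hnn]
    · rw [if_neg hf, mul_zero, mul_zero, zero_add]
      exact Finset.sum_nonneg hnn
  have h2 := blowupDensity_le_pow_mul hmax hz (by rw [hsum]; linarith)
  rw [hsum] at h2
  have h3 : (1 - x u) ^ Fintype.card α ≤ 1 - x u :=
    pow_le_of_le_one (by linarith) (by linarith) Fintype.card_ne_zero
  have h4 := mul_le_mul_of_nonneg_right h3 hM0
  have h5 : x u * M ≤ x u * (Fintype.card α * x u) := by nlinarith
  exact le_of_mul_le_mul_left h5 hupos

theorem blowupDensity_top_le_sum_sq {i j : α} (hij : i ≠ j) (hF : ¬F.Adj i j)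
    (hx : x ∈ stdSimplex ℝ V) : blowupDensity F ⊤ x ≤ ∑ v, x v ^ 2 := by
  classical
  have h := sum_prod_mul_pair hx.2 hij (fun a b => if a = b then 1 else 0)
  simp only [mul_ite, mul_one, mul_zero, Finset.sum_ite_eq, mem_univ, if_true] at h
  simp only [sq, ← h]
  refine Finset.sum_le_sum fun f _ => ?_
  have hprod : 0 ≤ ∏ a, x (f a) := Finset.prod_nonneg fun a _ => hx.1 _
  by_cases hf : (⊤ : SimpleGraph V).comap f = F
  · simp [hf, (comap_top_eq_iff.1 hf i j).2 hF]
  · simp only [hf, if_false, mul_zero]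
    split_ifs <;> simp [hprod]

open Classical in
omit [Fintype V] in
theorem prod_comp_eq_pow_mul_pow (z : V → ℝ) (f : α → V) {u v : V} (huv : u ≠ v) :
    ∏ i, z (f i) = z u ^ #{i | f i = u} * z v ^ #{i | f i = v} *
      ∏ i with f i ≠ u ∧ f i ≠ v, z (f i) := by
  rw [← Finset.prod_filter_mul_prod_filter_not univ (fun i => f i = u), mul_assoc,
    ← Finset.prod_filter_mul_prod_filter_not ({i | ¬f i = u} : Finset α) (fun i => f i = v),
    Finset.filter_filter, Finset.filter_filter, ← Finset.prod_const, ← Finset.prod_const]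
  have : ({i | ¬f i = u ∧ f i = v} : Finset α) = ({i | f i = v} : Finset α) := by
    ext i
    simp only [mem_filter, mem_univ, true_and, and_iff_right_iff_imp]
    rintro h rfl
    exact huv h
  rw [this]
  congr 1
  · exact Finset.prod_congr rfl fun i hi => by rw [(mem_filter.1 hi).2]
  · congr 1
    exact Finset.prod_congr rfl fun i hi => by rw [(mem_filter.1 hi).2]

/-- Among exponents at most two, `aᵐ bⁿ + bᵐ aⁿ` with `a + b` fixed is a convex function of `ab`. -/
theorem pow_mul_pow_add_le {a b t : ℝ} (hab : 0 ≤ a * b) (ht : t * (a + b) ^ 2 = 4 * (a * b)) {m n : ℕ}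
    (hm : m ≤ 2) (hn : n ≤ 2) :
    a ^ m * b ^ n + b ^ m * a ^ n ≤
      (1 - t) * ((a + b) ^ m * 0 ^ n + 0 ^ m * (a + b) ^ n) +
        t * (((a + b) / 2) ^ m * ((a + b) / 2) ^ n + ((a + b) / 2) ^ m * ((a + b) / 2) ^ n) := by
  interval_cases m <;> interval_cases n <;> norm_num <;> first
    | linarith
    | linear_combination (-1 / 2) * ht
    | linear_combination (1 / 2) * ht
    | linear_combination (-(a + b) / 4) * ht
    | linear_combination (-(a + b) ^ 2 / 8) * ht + (1 / 2) * mul_nonneg hab (sq_nonneg (a - b))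

theorem eq_of_max_blowupDensity_top
    (hF : ∀ (T : Finset α), (∀ i ∈ T, ∀ j ∈ T, ¬F.Adj i j) → #T ≤ 2)
    (hx : x ∈ stdSimplex ℝ V)
    (hmax : ∀ y ∈ stdSimplex ℝ V, blowupDensity F ⊤ y ≤ blowupDensity F ⊤ x)
    (hmin : ∀ y ∈ stdSimplex ℝ V, blowupDensity F ⊤ x ≤ blowupDensity F ⊤ y →
      #{v | x v ≠ 0} ≤ #{v | y v ≠ 0}) {u v : V} (hu : x u ≠ 0) (hv : x v ≠ 0) :
    x u = x v := by
  classical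
  by_contra hne
  have huv : u ≠ v := fun h => hne (h ▸ rfl)
  have hu' : 0 < x u := lt_of_le_of_ne (hx.1 u) (Ne.symm hu)
  have hv' : 0 < x v := lt_of_le_of_ne (hx.1 v) (Ne.symm hv)
  obtain ⟨t, ht⟩ : ∃ t, t * (x u + x v) ^ 2 = 4 * (x u * x v) :=
    ⟨4 * (x u * x v) / (x u + x v) ^ 2, by field_simp⟩
  have ht0 : 0 ≤ t := by
    by_contra! h
    nlinarith [mul_pos hu' hv', sq_pos_of_pos (add_pos hu' hv')]
  have ht1 : t < 1 := by
    by_contra! h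
    nlinarith [sq_pos_of_ne_zero (sub_ne_zero.2 hne), sq_pos_of_pos (add_pos hu' hv')]
  set y := Function.update (Function.update x u (x u + x v)) v 0 with hy
  set z := Function.update (Function.update x u ((x u + x v) / 2)) v ((x u + x v) / 2) with hz
  have hyS : y ∈ stdSimplex ℝ V :=
    update_update_mem_stdSimplex hx huv (by positivity) le_rfl (by simp)
  have hzS : z ∈ stdSimplex ℝ V :=
    update_update_mem_stdSimplex hx huv (by positivity) (by positivity) (by ring)
  let m : (V → ℝ) → (α → V) → ℝ := fun w f =>
    ((w u ^ #{i | f i = u} * w v ^ #{i | f i = v} + w v ^ #{i | f i = u} * w u ^ #{i | f i = v}) *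
      ∏ i with f i ≠ u ∧ f i ≠ v, w (f i)) * if (⊤ : SimpleGraph V).comap f = F then 1 else 0
  have hm : ∀ w : V → ℝ, 2 * blowupDensity F ⊤ w = ∑ f, m w f := by
    intro w
    have h1 : blowupDensity F ⊤ w = ∑ f : α → V, (∏ i, w (Equiv.swap u v (f i))) *
        if (⊤ : SimpleGraph V).comap f = F then 1 else 0 := by
      unfold blowupDensity
      rw [← (Equiv.arrowCongr (Equiv.refl α) (Equiv.swap u v)).sum_comp]
      refine Finset.sum_congr rfl fun f _ => ?_
      have : (⊤ : SimpleGraph V).comap (Equiv.swap u v ∘ f) = F ↔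
          (⊤ : SimpleGraph V).comap f = F := by
        rw [comap_top_eq_iff, comap_top_eq_iff]
        simp
      change (∏ i, w (Equiv.swap u v (f i))) *
        (if (⊤ : SimpleGraph V).comap (Equiv.swap u v ∘ f) = F then 1 else 0) = _
      rw [if_congr this rfl rfl]
    have h2 : blowupDensity F ⊤ w = ∑ f : α → V, (∏ i, w (f i)) *
        if (⊤ : SimpleGraph V).comap f = F then 1 else 0 := rfl
    rw [two_mul]
    nth_rw 1 [h2]
    rw [h1, ← Finset.sum_add_distrib]
    refine Finset.sum_congr rfl fun f _ => ?_
    rw [← add_mul, prod_comp_eq_pow_mul_pow w f huv,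
      prod_comp_eq_pow_mul_pow (fun a => w (Equiv.swap u v a)) f huv]
    have : ∏ i with f i ≠ u ∧ f i ≠ v, w (Equiv.swap u v (f i)) =
        ∏ i with f i ≠ u ∧ f i ≠ v, w (f i) := by
      refine Finset.prod_congr rfl fun i hi => ?_
      simp only [mem_filter] at hi
      rw [Equiv.swap_apply_of_ne_of_ne hi.2.1 hi.2.2]
    simp only [this, Equiv.swap_apply_left, Equiv.swap_apply_right, m]
    ring
  have hyu : y u = x u + x v := by simp [hy, huv]
  have hyv : y v = 0 := by simp [hy]
  have hzu : z u = (x u + x v) / 2 := by simp [hz, huv]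
  have hzv : z v = (x u + x v) / 2 := by simp [hz]
  have key : 2 * blowupDensity F ⊤ x ≤
      (1 - t) * (2 * blowupDensity F ⊤ y) + t * (2 * blowupDensity F ⊤ z) := by
    rw [hm, hm, hm, Finset.mul_sum, Finset.mul_sum, ← Finset.sum_add_distrib]
    refine Finset.sum_le_sum fun f _ => ?_
    by_cases hf : (⊤ : SimpleGraph V).comap f = F
    · have hcard : ∀ w : V, #{i | f i = w} ≤ 2 := fun w => hF _ fun i hi j hj =>
        (comap_top_eq_iff.1 hf i j).1 ((mem_filter.1 hi).2.trans (mem_filter.1 hj).2.symm)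
      have hR : ∀ w : V → ℝ, (∀ a, a ≠ u → a ≠ v → w a = x a) →
          ∏ i with f i ≠ u ∧ f i ≠ v, w (f i) = ∏ i with f i ≠ u ∧ f i ≠ v, x (f i) := by
        intro w hw
        refine Finset.prod_congr rfl fun i hi => ?_
        simp only [mem_filter] at hi
        exact hw _ hi.2.1 hi.2.2
      have hRy := hR y (fun a h1 h2 => by simp [hy, h1, h2])
      have hRz := hR z (fun a h1 h2 => by simp [hz, h1, h2])
      simp only [m, hf, if_true, mul_one, hRy, hRz, hyu, hyv, hzu, hzv]
      have h1 := mul_le_mul_of_nonneg_right (pow_mul_pow_add_le (mul_pos hu' hv').le ht (hcard u) (hcard v))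
        (show 0 ≤ ∏ i with f i ≠ u ∧ f i ≠ v, x (f i) from
          Finset.prod_nonneg fun i _ => hx.1 _)
      linarith
    · simp [m, hf]
  have h1 := hmax z hzS
  have h2 : blowupDensity F ⊤ x ≤ blowupDensity F ⊤ y := by nlinarith
  exact absurd (hmin y hyS h2) (not_le.2 (by convert card_support_update_lt _ hu hv))

end CompletePartite

section Counting

variable {α β : Type*} [Fintype α] [Fintype β] (F : SimpleGraph α) (G : SimpleGraph β)

omit [Fintype β] in
theorem exists_embedding_map_eq_iff {s : Finset β} :
    (∃ e : F ↪g G, univ.map e.toEmbedding = s) ↔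
      #s = Fintype.card α ∧ Nonempty (F ≃g G.induce (s : Set β)) := by
  constructor
  · rintro ⟨e, rfl⟩
    refine ⟨by simp, ⟨⟨(Equiv.ofInjective e e.injective).trans (Equiv.setCongr (by simp)), ?_⟩⟩⟩
    intro i j
    exact e.map_adj_iff
  · rintro ⟨-, ⟨φ⟩⟩
    refine ⟨(SimpleGraph.Embedding.induce (s : Set β)).comp φ.toEmbedding, ?_⟩
    ext b
    simp only [Finset.mem_map, mem_univ, true_and]
    constructor
    · rintro ⟨a, rfl⟩
      exact (φ a).2
    · intro hb
      exact ⟨φ.symm ⟨b, hb⟩, congrArg Subtype.val (φ.apply_symm_apply ⟨b, hb⟩)⟩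

omit [Fintype β] in
theorem card_embedding_map_eq (e₀ : F ↪g G) :
    Nat.card {e : F ↪g G // univ.map e.toEmbedding = univ.map e₀.toEmbedding} =
      Nat.card (F ≃g F) := by
  symm
  have hmem : ∀ φ : F ≃g F, univ.map (e₀.comp φ.toEmbedding).toEmbedding =
      univ.map e₀.toEmbedding := by
    intro φ
    ext b
    simp only [Finset.mem_map, mem_univ, true_and]
    exact (φ.surjective.exists (p := fun a => e₀ a = b)).symm
  refine Nat.card_eq_of_bijective (fun φ => ⟨e₀.comp φ.toEmbedding, hmem φ⟩) ⟨?_, ?_⟩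
  · intro φ ψ h
    ext i
    have := DFunLike.congr_fun (Subtype.ext_iff.1 h) i
    exact e₀.injective this
  · rintro ⟨e, he⟩
    have h1 : ∀ i, ∃ j, e₀ j = e i := by
      intro i
      have : e i ∈ univ.map e.toEmbedding := Finset.mem_map_of_mem _ (mem_univ i)
      rw [he] at this
      simpa using this
    choose σ hσ using h1
    have hinj : Function.Injective σ := fun i j hij => e.injective (by rw [← hσ, ← hσ, hij])
    refine ⟨⟨Equiv.ofBijective σ (Finite.injective_iff_bijective.1 hinj), ?_⟩, ?_⟩
    · intro i j
      change F.Adj (σ i) (σ j) ↔ F.Adj i j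
      rw [← e₀.map_adj_iff, hσ, hσ, e.map_adj_iff]
    · apply Subtype.ext
      ext i
      exact hσ i

theorem card_embedding_eq_mul_inducedCount :
    Nat.card (F ↪g G) = Nat.card (F ≃g F) * inducedCount F G := by
  classical
  have := Fintype.ofFinite (F ↪g G)
  have hset : {s : Finset β | #s = Fintype.card α ∧ Nonempty (F ≃g G.induce (s : Set β))} =
      (univ.image fun e : F ↪g G => univ.map e.toEmbedding : Finset (Finset β)) := by
    ext s
    rw [Set.mem_ofPred_eq, ← exists_embedding_map_eq_iff]
    simp
  rw [inducedCount, hset, Set.ncard_coe_finset, Nat.card_eq_fintype_card, ← Finset.card_univ,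
    Finset.card_eq_sum_card_image (fun e : F ↪g G => univ.map e.toEmbedding),
    Finset.sum_const_nat (m := Nat.card (F ≃g F)), mul_comm]
  intro s hs
  obtain ⟨e₀, -, rfl⟩ := Finset.mem_image.1 hs
  rw [← card_embedding_map_eq F G e₀, Nat.card_eq_fintype_card, Fintype.card_subtype]

open Classical in
theorem card_embedding_eq_sum :
    (Nat.card (F ↪g G) : ℝ) = ∑ e : α ↪ β, if G.comap e = F then 1 else 0 := by
  have : (F ↪g G) ≃ {e : α ↪ β // G.comap e = F} :=
    { toFun := fun e => ⟨e.toEmbedding, comap_eq_iff.2 fun i j => e.map_adj_iff⟩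
      invFun := fun e => ⟨e.1, fun {i j} => comap_eq_iff.1 e.2 i j⟩
      left_inv := fun e => rfl
      right_inv := fun e => rfl }
  rw [Nat.card_congr this, Nat.card_eq_fintype_card, Fintype.card_subtype, Finset.sum_boole]

theorem card_embedding_le :
    (Nat.card (F ↪g G) : ℝ) ≤ (Fintype.card β : ℝ) ^ Fintype.card α *
      blowupDensity F G fun _ => (Fintype.card β : ℝ)⁻¹ := by
  classical
  rcases isEmpty_or_nonempty β with hβ | hβ
  · rcases isEmpty_or_nonempty α with hα | hα
    · have hF : ∀ f : α → β, G.comap f = F := fun f => comap_eq_iff.2 fun i => isEmptyElim i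
      have : ∀ e : α ↪ β, G.comap e = F := fun f => hF f
      rw [card_embedding_eq_sum]
      simp [blowupDensity, hF]
    · have : IsEmpty (F ↪g G) := ⟨fun e => isEmptyElim (e (Classical.arbitrary α))⟩
      simp
  · have hn : (Fintype.card β : ℝ) ≠ 0 := by simp
    have h : (Fintype.card β : ℝ) ^ Fintype.card α *
        (blowupDensity F G fun _ => (Fintype.card β : ℝ)⁻¹) =
        ∑ f : α → β, if G.comap f = F then (1 : ℝ) else 0 := by
      unfold blowupDensity
      rw [Finset.mul_sum]
      refine Finset.sum_congr rfl fun f _ => ?_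
      rw [Finset.prod_const, Finset.card_univ, ← mul_assoc, ← mul_pow, mul_inv_cancel₀ hn, one_pow,
        one_mul]
    rw [h, card_embedding_eq_sum]
    have hsum := Finset.sum_map (univ : Finset (α ↪ β)) ⟨fun e => (e : α → β), DFunLike.coe_injective⟩
      (fun f => if G.comap f = F then (1 : ℝ) else 0)
    simp only [Function.Embedding.coeFn_mk] at hsum
    rw [← hsum]
    exact Finset.sum_le_univ_sum_of_nonneg fun f => by split_ifs <;> simp

theorem sum_mul_card_embedding {V : Type*} [Fintype V] [DecidableEq β] (H : SimpleGraph V)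
    {x : V → ℝ} (hx : ∑ v, x v = 1) :
    ∑ g : β → V, (∏ b, x (g b)) * (Nat.card (F ↪g H.comap g) : ℝ) =
      (Fintype.card β).descFactorial (Fintype.card α) * blowupDensity F H x := by
  classical
  simp only [card_embedding_eq_sum, Finset.mul_sum]
  rw [Finset.sum_comm]
  have : ∀ e : α ↪ β, ∑ g : β → V, (∏ b, x (g b)) *
      (if (H.comap g).comap e = F then (1 : ℝ) else 0) = blowupDensity F H x := fun e =>
    sum_prod_mul_comp_embedding hx e fun f => if H.comap f = F then 1 else 0
  simp only [this]
  simp [Fintype.card_embedding_eq]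

theorem inducedDensity_eq :
    inducedDensity F G = ((Fintype.card α).factorial / Nat.card (F ≃g F) : ℝ) *
      (Nat.card (F ↪g G) / (Fintype.card β).descFactorial (Fintype.card α)) := by
  have h1 : (Nat.card (F ≃g F) : ℝ) ≠ 0 := by
    have : Finite (F ≃g F) := Finite.of_injective _ RelIso.toEquiv_injective
    exact_mod_cast Nat.card_pos.ne'
  have h2 : ((Fintype.card α).factorial : ℝ) ≠ 0 := by exact_mod_cast Nat.factorial_ne_zero _
  rw [card_embedding_eq_mul_inducedCount, Nat.descFactorial_eq_factorial_mul_choose, inducedDensity]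
  push_cast
  rw [div_mul_div_comm, mul_left_comm _ (_ : ℝ) (inducedCount F G : ℝ),
    mul_div_mul_left _ _ h1, mul_div_mul_left _ _ h2]

end Counting

section Limit

variable {α : Type*} [Fintype α] (F : SimpleGraph α)

/-- The supremum of the weighted densities of `F` in blow-ups of `K_k`-free graphs. -/
noncomputable def supBlowupDensity (k : ℕ) : ℝ :=
  sSup {y : ℝ | ∃ (N : ℕ) (G : SimpleGraph (Fin N)), ∃ x ∈ stdSimplex ℝ (Fin N),
    G.CliqueFree k ∧ y = blowupDensity F G x}

theorem le_supBlowupDensity {k N : ℕ} {G : SimpleGraph (Fin N)} {x : Fin N → ℝ}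
    (hx : x ∈ stdSimplex ℝ (Fin N)) (hG : G.CliqueFree k) :
    blowupDensity F G x ≤ supBlowupDensity F k :=
  le_csSup ⟨1, by rintro _ ⟨N, G, x, hx, -, rfl⟩; exact blowupDensity_le_one hx⟩
    ⟨N, G, x, hx, hG, rfl⟩

theorem supBlowupDensity_nonneg (k : ℕ) : 0 ≤ supBlowupDensity F k :=
  Real.sSup_nonneg (by rintro _ ⟨N, G, x, hx, -, rfl⟩; exact blowupDensity_nonneg hx.1)

theorem supBlowupDensity_le {k : ℕ} {c : ℝ} (hc : 0 ≤ c)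
    (h : ∀ (N : ℕ) (G : SimpleGraph (Fin N)), ∀ x ∈ stdSimplex ℝ (Fin N), G.CliqueFree k →
      blowupDensity F G x ≤ c) : supBlowupDensity F k ≤ c :=
  Real.sSup_le (by rintro _ ⟨N, G, x, hx, hG, rfl⟩; exact h N G x hx hG) hc

/-- The number `|V(F)|! / |Aut F|` of distinct labellings of `F`. -/
noncomputable def labellingCount : ℝ := (Fintype.card α).factorial / Nat.card (F ≃g F)

theorem labellingCount_pos : 0 < labellingCount F := by
  have : Finite (F ≃g F) := Finite.of_injective _ RelIso.toEquiv_injective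
  have : 0 < Nat.card (F ≃g F) := Nat.card_pos
  have := Nat.factorial_pos (Fintype.card α)
  unfold labellingCount
  positivity

theorem inducedDensity_nonneg {β : Type*} [Fintype β] (G : SimpleGraph β) :
    0 ≤ inducedDensity F G := by
  unfold inducedDensity
  positivity

theorem inducedDensity_le_ikn {k n : ℕ} {G : SimpleGraph (Fin n)} (hG : G.CliqueFree k) :
    inducedDensity F G ≤ ikn F k n := by
  refine le_csSup (Set.Finite.bddAbove ?_) ⟨G, hG, rfl⟩
  refine (Set.finite_range fun G : SimpleGraph (Fin n) => inducedDensity F G).subset ?_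
  rintro _ ⟨G, -, rfl⟩
  exact ⟨G, rfl⟩

theorem ikn_nonneg (k n : ℕ) : 0 ≤ ikn F k n :=
  Real.sSup_nonneg (by rintro _ ⟨G, -, rfl⟩; exact inducedDensity_nonneg F G)

theorem ikn_le {k n : ℕ} (hn : n ≠ 0) :
    ikn F k n ≤ labellingCount F * supBlowupDensity F k *
      ((n : ℝ) ^ Fintype.card α / n.descFactorial (Fintype.card α)) := by
  have hc := (labellingCount_pos F).le
  have hL := supBlowupDensity_nonneg F k
  refine Real.sSup_le ?_ (by positivity)
  rintro _ ⟨G, hG, rfl⟩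
  rw [inducedDensity_eq, ← labellingCount, Fintype.card_fin, mul_assoc]
  refine mul_le_mul_of_nonneg_left ?_ hc
  rw [mul_div_assoc']
  refine div_le_div_of_nonneg_right ?_ (by positivity)
  have h := card_embedding_le F G
  rw [Fintype.card_fin, mul_comm] at h
  refine h.trans (mul_le_mul_of_nonneg_right ?_ (by positivity))
  refine le_supBlowupDensity F ⟨fun _ => by positivity, ?_⟩ hG
  have : (n : ℝ) ≠ 0 := by exact_mod_cast hn
  simp [this]

theorem mul_supBlowupDensity_le_ikn {k n : ℕ} (hn : Fintype.card α ≤ n) :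
    labellingCount F * supBlowupDensity F k ≤ ikn F k n := by
  have hc := labellingCount_pos F
  have hD : (0 : ℝ) < n.descFactorial (Fintype.card α) := by
    exact_mod_cast Nat.descFactorial_pos.2 hn
  rw [← le_div_iff₀' hc]
  refine supBlowupDensity_le F (div_nonneg (ikn_nonneg F k n) hc.le) fun N H x hx hH => ?_
  rw [le_div_iff₀' hc]
  have hle : ∀ g : Fin n → Fin N,
      labellingCount F * Nat.card (F ↪g H.comap g) ≤
        ikn F k n * n.descFactorial (Fintype.card α) := by
    intro g
    have hfree : (H.comap g).CliqueFree k := by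
      classical
      intro s hs
      rw [SimpleGraph.isNClique_iff, SimpleGraph.isClique_iff] at hs
      refine hH (s.image g) (SimpleGraph.isNClique_iff _ |>.2 ⟨?_, ?_⟩)
      · rintro _ ha' _ hb' hab
        obtain ⟨a, ha, rfl⟩ := Finset.mem_image.1 (Finset.mem_coe.1 ha')
        obtain ⟨b, hb, rfl⟩ := Finset.mem_image.1 (Finset.mem_coe.1 hb')
        exact hs.1 (Finset.mem_coe.2 ha) (Finset.mem_coe.2 hb) fun h => hab (h ▸ rfl)
      · rw [Finset.card_image_of_injOn, hs.2]
        intro a ha b hb hab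
        by_contra hne
        have h : H.Adj (g a) (g b) := hs.1 ha hb hne
        exact h.ne hab
    have h := inducedDensity_le_ikn F hfree
    rwa [inducedDensity_eq, ← labellingCount, Fintype.card_fin, mul_div_assoc',
      div_le_iff₀ hD] at h
  have h := sum_mul_card_embedding (β := Fin n) F H hx.2
  rw [Fintype.card_fin] at h
  have h2 : ∑ g : Fin n → Fin N, (∏ b, x (g b)) *
      (labellingCount F * Nat.card (F ↪g H.comap g)) ≤
      ∑ g : Fin n → Fin N, (∏ b, x (g b)) * (ikn F k n * n.descFactorial (Fintype.card α)) :=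
    Finset.sum_le_sum fun g _ =>
      mul_le_mul_of_nonneg_left (hle g) (Finset.prod_nonneg fun i _ => hx.1 _)
  rw [← Finset.sum_mul, sum_prod_eq_one hx.2, one_mul] at h2
  simp only [mul_left_comm _ (labellingCount F)] at h2
  rw [← Finset.mul_sum, h, mul_left_comm, mul_comm (ikn F k n)] at h2
  exact le_of_mul_le_mul_left h2 hD

theorem ik_eq (k : ℕ) : ik F k = labellingCount F * supBlowupDensity F k := by
  refine Tendsto.limUnder_eq ?_
  have hlim : Tendsto (fun n : ℕ => (n : ℝ) ^ Fintype.card α /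
      n.descFactorial (Fintype.card α)) atTop (𝓝 1) := by
    refine (Asymptotics.isEquivalent_iff_tendsto_one ?_).1
      (isEquivalent_descFactorial (Fintype.card α)).symm
    filter_upwards [eventually_ge_atTop (Fintype.card α)] with n hn
    exact_mod_cast (Nat.descFactorial_pos.2 hn).ne'
  refine tendsto_of_tendsto_of_tendsto_of_le_of_le' tendsto_const_nhds
    (by simpa using hlim.const_mul (labellingCount F * supBlowupDensity F k)) ?_ ?_
  · filter_upwards [eventually_ge_atTop (Fintype.card α)] with n hn
    exact mul_supBlowupDensity_le_ikn F hn
  · filter_upwards [eventually_ne_atTop 0] with n hn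
    exact ikn_le F hn

theorem inducibilityDiverse_iff :
    InducibilityDiverse F ↔ ∀ k, ∃ m, k < m ∧ supBlowupDensity F k < supBlowupDensity F m := by
  simp only [InducibilityDiverse, ik_eq, mul_lt_mul_iff_right₀ (labellingCount_pos F)]

end Limit

section Diversity

variable {α : Type*} [Fintype α] {F : SimpleGraph α}

theorem inducibilityDiverse_top (hα : Nontrivial α) :
    InducibilityDiverse (⊤ : SimpleGraph α) := by
  classical
  rw [inducibilityDiverse_iff]
  intro k
  have hlt : supBlowupDensity (⊤ : SimpleGraph α) k < 1 := by
    set δ : ℝ := (1 / ((k : ℝ) + 1)) ^ Fintype.card α with hδ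
    have hδ0 : 0 < δ := by positivity
    have hδ1 : δ ≤ 1 := pow_le_one₀ (by positivity) (by
      rw [div_le_one (by positivity)]
      have : (0 : ℝ) ≤ k := by positivity
      linarith)
    refine lt_of_le_of_lt (supBlowupDensity_le _ (c := 1 - δ) (by linarith) ?_) (by linarith)
    intro N G x hx hG
    have : Nonempty (Fin N) := by
      by_contra h
      rw [not_nonempty_iff] at h
      simpa using hx.2
    obtain ⟨y, hy, hclique, hle⟩ := exists_isClique_support (F := (⊤ : SimpleGraph α))
      (by simp only [SimpleGraph.top_adj, not_not]; exact fun _ _ _ => Eq.trans) G hx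
    refine hle.trans ?_
    have hcard : #{v | y v ≠ 0} < k := by
      by_contra! h
      exact (hG.mono h) _ (SimpleGraph.isNClique_iff _ |>.2 ⟨by simpa using hclique, rfl⟩)
    obtain ⟨u, hu⟩ : ∃ u, 1 / ((k : ℝ) + 1) ≤ y u := by
      by_contra! h
      have h1 : ∑ v with y v ≠ 0, y v = 1 := by rw [Finset.sum_filter_ne_zero, hy.2]
      have h2 := Finset.sum_le_card_nsmul ({v | y v ≠ 0} : Finset (Fin N)) y _
        fun v _ => (h v).le
      rw [h1, nsmul_eq_mul, mul_one_div, le_div_iff₀ (by positivity)] at h2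
      have h3 : (#{v | y v ≠ 0} : ℝ) < k := by exact_mod_cast hcard
      linarith
    obtain ⟨i, j, hij⟩ := hα
    have hconst : ¬G.comap (fun _ : α => u) = ⊤ := by
      intro h
      have := (comap_eq_iff.1 h i j).2 hij
      exact G.loopless.irrefl u this
    have h1 := sum_prod_eq_one (α := α) hy.2
    rw [← Finset.add_sum_erase _ _ (mem_univ fun _ => u)] at h1
    simp only [Finset.prod_const, Finset.card_univ] at h1
    have h2 : δ ≤ y u ^ Fintype.card α := pow_le_pow_left₀ (by positivity) hu _
    have h3 : blowupDensity (⊤ : SimpleGraph α) G y ≤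
        ∑ f ∈ univ.erase (fun _ : α => u), ∏ i, y (f i) := by
      unfold blowupDensity
      rw [← Finset.add_sum_erase _ _ (mem_univ fun _ => u), if_neg hconst, mul_zero, zero_add]
      refine Finset.sum_le_sum fun f _ => mul_le_of_le_one_right
        (Finset.prod_nonneg fun a _ => hy.1 _) ?_
      split_ifs <;> simp
    linarith
  have hlim : Tendsto (fun n : ℕ => (n.descFactorial (Fintype.card α) : ℝ) /
      (n : ℝ) ^ Fintype.card α) atTop (𝓝 1) := by
    refine (Asymptotics.isEquivalent_iff_tendsto_one ?_).1
      (isEquivalent_descFactorial (Fintype.card α))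
    filter_upwards [eventually_ne_atTop 0] with n hn
    positivity
  obtain ⟨n, hn, hkn, hn0⟩ := ((hlim.eventually_const_lt hlt).and
    ((eventually_ge_atTop k).and (eventually_ne_atTop 0))).exists
  refine ⟨n + 1, by omega, hn.trans_le ?_⟩
  have hn' : (n : ℝ) ≠ 0 := by exact_mod_cast hn0
  have hcf : (⊤ : SimpleGraph (Fin n)).CliqueFree (n + 1) :=
    SimpleGraph.cliqueFree_of_card_lt (by simp)
  refine le_of_eq_of_le ?_ (le_supBlowupDensity (⊤ : SimpleGraph α) (x := fun _ => (n : ℝ)⁻¹)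
    ⟨fun _ => by positivity, by simp [hn']⟩ hcf)
  have hinj : ∀ f : α → Fin n, (⊤ : SimpleGraph (Fin n)).comap f = ⊤ ↔ Function.Injective f := by
    intro f
    rw [comap_top_eq_iff]
    simp only [SimpleGraph.top_adj, not_not]
    exact ⟨fun h i j => (h i j).1, fun h i j => h.eq_iff⟩
  have hcount : #{f : α → Fin n | Function.Injective f} =
      n.descFactorial (Fintype.card α) := by
    have h1 := Fintype.card_embedding_eq (α := α) (β := Fin n)
    rw [Fintype.card_fin] at h1
    rw [← h1, ← Fintype.card_subtype]
    exact Fintype.card_congr (Equiv.subtypeInjectiveEquivEmbedding α (Fin n))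
  unfold blowupDensity
  simp only [hinj, Finset.prod_const, Finset.card_univ]
  rw [← Finset.mul_sum, Finset.sum_boole, hcount, inv_pow, div_eq_inv_mul]

/-- If every maximizer with minimal support has all its weights at least proportional to the
density, then bounded supports suffice and `F` is not inducibility diverse. -/
theorem not_inducibilityDiverse (hF : ∀ i j k, ¬F.Adj i j → ¬F.Adj j k → ¬F.Adj i k)
    (h : ∀ (N : ℕ), ∀ x ∈ stdSimplex ℝ (Fin N),
      (∀ y ∈ stdSimplex ℝ (Fin N), blowupDensity F ⊤ y ≤ blowupDensity F ⊤ x) →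
      (∀ y ∈ stdSimplex ℝ (Fin N), blowupDensity F ⊤ x ≤ blowupDensity F ⊤ y →
        #{v | x v ≠ 0} ≤ #{v | y v ≠ 0}) →
      ∀ u, x u ≠ 0 → blowupDensity F ⊤ x ≤ Fintype.card α * x u)
    (hα : Nonempty α) : ¬InducibilityDiverse F := by
  classical
  rw [inducibilityDiverse_iff]
  push Not
  obtain ⟨k₀, hk₀⟩ : ∃ k₀, ∀ k, k₀ ≤ k → 0 < supBlowupDensity F k := by
    refine ⟨Fintype.card α + 1, fun k hk => ?_⟩
    set s := Fintype.card α with hs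
    have hs0 : (s : ℝ) ≠ 0 := by simp [hs]
    let e := Fintype.equivFin α
    have hcf : (F.comap e.symm).CliqueFree k := SimpleGraph.cliqueFree_of_card_lt (by simp; omega)
    refine lt_of_lt_of_le ?_ (le_supBlowupDensity F (x := fun _ => (s : ℝ)⁻¹)
      ⟨fun _ => by positivity, by simp [← hs, hs0]⟩ hcf)
    unfold blowupDensity
    refine Finset.sum_pos' (fun f _ => mul_nonneg (by positivity) (by split_ifs <;> simp))
      ⟨e, mem_univ _, ?_⟩
    have : (F.comap e.symm).comap e = F := comap_eq_iff.2 fun i j => by simp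
    rw [if_pos this]
    have := Fintype.card_pos (α := α)
    positivity
  set c := supBlowupDensity F k₀ with hc
  have hc0 : 0 < c := hk₀ k₀ le_rfl
  obtain ⟨K, hK⟩ := exists_nat_ge (Fintype.card α / c)
  have hmono : ∀ k, k₀ ≤ k → c ≤ supBlowupDensity F k := fun k hk =>
    supBlowupDensity_le F (supBlowupDensity_nonneg F k) fun N G x hx hG =>
      le_supBlowupDensity F hx (hG.mono hk)
  refine ⟨max k₀ (K + 2), fun m _ => ?_⟩
  refine supBlowupDensity_le F (supBlowupDensity_nonneg F _) fun N G x hx _ => ?_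
  have : Nonempty (Fin N) := by
    by_contra h
    rw [not_nonempty_iff] at h
    simpa using hx.2
  obtain ⟨y, hy, hclique, hxy⟩ := exists_isClique_support hF G hx
  have hytop : blowupDensity F G y = blowupDensity F ⊤ y :=
    blowupDensity_congr_of_clique fun u v hu hv =>
      ⟨fun h => h.ne, fun h => hclique hu hv h⟩
  obtain ⟨z, hz, hmax, hmin⟩ := exists_max_blowupDensity F (⊤ : SimpleGraph (Fin N))
  refine (hxy.trans (hytop.le.trans (hmax y hy))).trans ?_
  rcases le_total (blowupDensity F ⊤ z) c with hzc | hzc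
  · exact hzc.trans (hmono _ (le_max_left _ _))
  have hw : ∀ u, z u ≠ 0 → c ≤ Fintype.card α * z u := fun u hu =>
    hzc.trans (h N z hz hmax hmin u hu)
  have hcard : #{v | z v ≠ 0} ≤ K := by
    have h1 : ∑ v with z v ≠ 0, Fintype.card α * z v = (Fintype.card α : ℝ) := by
      rw [← Finset.mul_sum, Finset.sum_filter_ne_zero, hz.2, mul_one]
    have h2 := Finset.card_nsmul_le_sum ({v | z v ≠ 0} : Finset (Fin N))
      (fun v => Fintype.card α * z v) c fun v hv => hw v (by simpa using hv)
    rw [h1, nsmul_eq_mul, ← le_div_iff₀ hc0] at h2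
    exact_mod_cast h2.trans hK
  let S : SimpleGraph (Fin N) :=
    { Adj := fun a b => a ≠ b ∧ z a ≠ 0 ∧ z b ≠ 0
      symm := ⟨fun a b hab => ⟨hab.1.symm, hab.2.2, hab.2.1⟩⟩
      loopless := ⟨fun a ha => ha.1 rfl⟩ }
  have hS : blowupDensity F ⊤ z = blowupDensity F S z :=
    blowupDensity_congr_of_clique fun u v hu hv => by simp [S, hu, hv]
  rw [hS]
  refine le_supBlowupDensity F hz (SimpleGraph.CliqueFree.mono (le_max_right _ _) ?_)
  intro T hT
  rw [SimpleGraph.isNClique_iff] at hT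
  have hsub : T ⊆ ({v | z v ≠ 0} : Finset (Fin N)) := by
    intro a ha
    obtain ⟨b, hb, hba⟩ := Finset.exists_mem_ne (s := T) (by omega) a
    simpa using (hT.1 ha hb hba.symm).2.1
  have := Finset.card_le_card hsub
  omega

theorem not_inducibilityDiverse_turanGraph {r s : ℕ} (hr : 2 ≤ r) (hrs : r < s) :
    ¬InducibilityDiverse (SimpleGraph.turanGraph s r) := by
  have : Nonempty (Fin s) := ⟨⟨0, by omega⟩⟩
  refine not_inducibilityDiverse ?_ ?_ this
  · intro i j k hij hjk
    simp only [SimpleGraph.turanGraph_adj, not_not] at *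
    exact hij.trans hjk
  intro N x hx hmax hmin u hu
  rcases le_or_gt (2 * r) s with h2 | h2
  · refine blowupDensity_top_le_card_mul (fun i => ?_) hx hmax hu
    by_cases hi : (i : ℕ) < r
    · refine ⟨⟨i + r, by omega⟩, fun h => ?_, ?_⟩
      · have := congrArg Fin.val h
        simp only at this
        omega
      · simp [SimpleGraph.turanGraph_adj]
    · refine ⟨⟨i - r, by omega⟩, fun h => ?_, ?_⟩
      · have := congrArg Fin.val h
        simp only at this
        omega
      · rw [SimpleGraph.turanGraph_adj, not_not]
        exact Nat.mod_eq_sub_mod (by omega)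
  · have hsq := blowupDensity_top_le_sum_sq (F := SimpleGraph.turanGraph s r)
      (i := ⟨0, by omega⟩) (j := ⟨r, by omega⟩)
      (fun h => by have := congrArg Fin.val h; simp only at this; omega)
      (by simp [SimpleGraph.turanGraph_adj]) hx
    have hpair : ∀ i j : Fin s, i < j → ¬(SimpleGraph.turanGraph s r).Adj i j →
        (i : ℕ) + r = j := by
      intro i j hij h
      rw [SimpleGraph.turanGraph_adj, not_not] at h
      have h1 : r ∣ (j : ℕ) - i := (Nat.modEq_iff_dvd' (by omega)).1 h
      obtain ⟨d, hd⟩ := h1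
      have hj := j.2
      have hij' : (i : ℕ) < j := hij
      have : d < 2 := by
        by_contra! hd2
        have := Nat.mul_le_mul_left r hd2
        omega
      have : d ≠ 0 := by rintro rfl; omega
      obtain rfl : d = 1 := by omega
      omega
    have heq := fun v hv => eq_of_max_blowupDensity_top (F := SimpleGraph.turanGraph s r)
      (fun T hT => by
        by_contra! hcard
        obtain ⟨a, b, c, ha, hb, hc, hab, hac, hbc⟩ := Finset.two_lt_card_iff.1 hcard
        have hadj : ∀ i ∈ T, ∀ j ∈ T, i ≠ j → (i : ℕ) + r = j ∨ (j : ℕ) + r = i :=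
          fun i hi j hj hij => (lt_or_gt_of_ne hij).imp (fun h => hpair i j h (hT i hi j hj))
            fun h => hpair j i h (hT j hj i hi)
        have h3 := hadj a ha b hb hab
        have h4 := hadj a ha c hc hac
        have h5 := hadj b hb c hc hbc
        omega) hx hmax hmin (u := v) (v := u) hv hu
    have hsum : ∑ v, x v ^ 2 = x u := by
      have : ∀ v, x v ^ 2 = x v * x u := by
        intro v
        by_cases hv : x v = 0
        · simp [hv]
        · rw [sq, heq v hv]
      simp only [this, ← Finset.sum_mul, hx.2, one_mul]
    rw [hsum] at hsq
    refine hsq.trans (le_mul_of_one_le_left (hx.1 u) ?_)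
    exact_mod_cast Fintype.card_pos

end Diversity

end

/-- For `2 ≤ r ≤ s`, the Turán graph `T(s,r)` is inducibility diverse if and only if
it is a complete graph, i.e. `s = r`. -/
theorem stmt14 {r s : ℕ} (hr : 2 ≤ r) (hrs : r ≤ s) :
    InducibilityDiverse (SimpleGraph.turanGraph s r) ↔ s = r := by
  constructor
  · intro h
    by_contra hne
    exact not_inducibilityDiverse_turanGraph hr (by omega) h
  · rintro rfl
    have htop : SimpleGraph.turanGraph s s = ⊤ := by
      ext i j
      rw [SimpleGraph.turanGraph_adj, SimpleGraph.top_adj, Nat.mod_eq_of_lt i.2,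
        Nat.mod_eq_of_lt j.2, Ne, Fin.val_inj]
    rw [htop]
    exact inducibilityDiverse_top (Fin.nontrivial_iff_two_le.2 hr)
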